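/- Let G be a group with a measurable right action on a probability space (X, 𝒜, ν), denoted x·g. Let μ be a symmetric probability measure on G (i.e. the pushforward of μ under g ↦ g⁻¹ equals μ) such that for μ-almost every g ∈ G the map x ↦ x·g preserves ν. Let B = G^ℕ carry the infinite product measure β = μ^⊗ℕ, and let T : X × B → X × B be the skew-product map T(x, b) = (x·b₀, shift(b)), where shift(b)ₙ = b_{n+1}; assume T is measure-preserving and ergodic with respect to ν ⊗ β. Let σ : X × G → ℝ^d be a measurable ℝ^d-valued cocycle that is integrable with respect to ν ⊗ μ. Then for ν ⊗ β-almost every (x, b) ∈ X × B, (1/n)·σ(x, b₀b₁⋯b_{n−1}) → 0 as n → ∞. -/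

import Mathlib

open MeasureTheory Filter Topology

/-- The maximum of `0` and the first `n` Birkhoff sums of `f` along `T`, defined recursively. -/
noncomputable def birkhoffMax {α : Type*} (T : α → α) (f : α → ℝ) : ℕ → α → ℝ
  | 0 => fun _ => 0
  | n + 1 => fun x => max 0 (f x + birkhoffMax T f n (T x))

section BirkhoffMax

variable {α : Type*} {T : α → α} {f : α → ℝ}

lemma birkhoffMax_nonneg (n : ℕ) (x : α) : 0 ≤ birkhoffMax T f n x := by
  cases n with
  | zero => exact le_rfl
  | succ n => exact le_max_left _ _

lemma birkhoffMax_le_succ (n : ℕ) (x : α) :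
    birkhoffMax T f n x ≤ birkhoffMax T f (n + 1) x := by
  induction n generalizing x with
  | zero => exact birkhoffMax_nonneg 1 x
  | succ n ih => exact max_le_max le_rfl (by linarith [ih (T x)])

lemma monotone_birkhoffMax (x : α) : Monotone fun n => birkhoffMax T f n x :=
  monotone_nat_of_le_succ fun n => birkhoffMax_le_succ n x

lemma birkhoffSum_le_birkhoffMax (n : ℕ) (x : α) :
    birkhoffSum T f n x ≤ birkhoffMax T f n x := by
  induction n generalizing x with
  | zero => simp [birkhoffMax]
  | succ n ih =>
    rw [birkhoffSum_succ']
    exact (add_le_add le_rfl (ih (T x))).trans (le_max_right _ _)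

lemma birkhoffMax_succ_sub (n : ℕ) (x : α) :
    birkhoffMax T f (n + 1) x - birkhoffMax T f n (T x) =
      max (f x) (-birkhoffMax T f n (T x)) := by
  simp only [birkhoffMax]
  rw [← max_sub_sub_right, max_comm]
  congr 1 <;> ring

lemma bddAbove_birkhoffMax_comp_iff (x : α) :
    BddAbove (Set.range fun n => birkhoffMax T f n (T x)) ↔
      BddAbove (Set.range fun n => birkhoffMax T f n x) := by
  constructor
  · rintro ⟨C, hC⟩
    refine ⟨max 0 (f x + C), ?_⟩
    rintro _ ⟨n, rfl⟩
    refine (birkhoffMax_le_succ n x).trans (max_le_max le_rfl ?_)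
    linarith [hC ⟨n, rfl⟩]
  · rintro ⟨C, hC⟩
    refine ⟨C - f x, ?_⟩
    rintro _ ⟨n, rfl⟩
    have h : birkhoffMax T f (n + 1) x ≤ C := hC ⟨n + 1, rfl⟩
    have h' : f x + birkhoffMax T f n (T x) ≤ birkhoffMax T f (n + 1) x := le_max_right _ _
    change birkhoffMax T f n (T x) ≤ C - f x
    linarith

lemma birkhoffSum_sub_const (c : ℝ) (n : ℕ) (x : α) :
    birkhoffSum T (fun y => f y - c) n x = birkhoffSum T f n x - n * c := by
  simp [birkhoffSum, Finset.sum_sub_distrib]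

variable [MeasurableSpace α] {m : Measure α}

lemma measurable_birkhoffMax (hT : Measurable T) (hf : Measurable f) (n : ℕ) :
    Measurable (birkhoffMax T f n) := by
  induction n with
  | zero => exact measurable_const
  | succ n ih => exact measurable_const.max (hf.add (ih.comp hT))

lemma integrable_birkhoffMax (hT : MeasurePreserving T m m) (hf : Integrable f m) (n : ℕ) :
    Integrable (birkhoffMax T f n) m := by
  induction n with
  | zero => exact integrable_zero _ _ _
  | succ n ih =>
    exact (integrable_zero _ _ _).sup (hf.add (hT.integrable_comp_of_integrable ih))

/-- If the maximal Birkhoff sums are almost surely unbounded, then `f` has nonnegative integral. -/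
lemma integral_nonneg_of_ae_not_bddAbove_birkhoffMax
    (hT : MeasurePreserving T m m) (hf : Integrable f m)
    (hunb : ∀ᵐ x ∂m, ¬ BddAbove (Set.range fun n => birkhoffMax T f n x)) :
    0 ≤ ∫ x, f x ∂m := by
  have hi := integrable_birkhoffMax hT hf
  have hiT n : Integrable (fun x => birkhoffMax T f n (T x)) m :=
    hT.integrable_comp_of_integrable (hi n)
  have hlim : Tendsto (fun n => ∫ x, max (f x) (-birkhoffMax T f n (T x)) ∂m) atTop
      (𝓝 (∫ x, f x ∂m)) := by
    refine tendsto_integral_of_dominated_convergence (fun x => |f x|)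
      (fun n => (hf.sup (hiT n).neg).aestronglyMeasurable) hf.abs (fun n => ?_) ?_
    · filter_upwards with x
      rw [Real.norm_eq_abs, abs_le]
      have := birkhoffMax_nonneg (T := T) (f := f) n (T x)
      exact ⟨(neg_abs_le _).trans (le_max_left _ _),
        max_le (le_abs_self _) (by linarith [abs_nonneg (f x)])⟩
    · filter_upwards [hunb] with x hx
      rw [← bddAbove_birkhoffMax_comp_iff] at hx
      have htop := tendsto_atTop_atTop_of_monotone' (monotone_birkhoffMax (T x)) hx
      refine tendsto_const_nhds.congr' ?_
      filter_upwards [htop.eventually_ge_atTop (-f x)] with n hn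
      rw [max_eq_left (by linarith)]
  refine ge_of_tendsto' hlim fun n => ?_
  simp_rw [← birkhoffMax_succ_sub]
  rw [integral_sub (hi (n + 1)) (hiT n), sub_nonneg]
  have hmap : ∫ x, birkhoffMax T f n (T x) ∂m = ∫ x, birkhoffMax T f n x ∂m := by
    rw [← integral_map hT.aemeasurable (by rw [hT.map_eq]; exact (hi n).aestronglyMeasurable),
      hT.map_eq]
  rw [hmap]
  exact integral_mono (hi n) (hi (n + 1)) fun x => birkhoffMax_le_succ n x

lemma Ergodic.ae_bddAbove_birkhoffSum (hT : Ergodic T m) (hfm : Measurable f)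
    (hf : Integrable f m) (hneg : ∫ x, f x ∂m < 0) :
    ∀ᵐ x ∂m, BddAbove (Set.range fun n => birkhoffSum T f n x) := by
  have hmeas : MeasurableSet {x | BddAbove (Set.range fun n => birkhoffMax T f n x)} :=
    measurableSet_bddAbove_range fun n => measurable_birkhoffMax hT.measurable hfm n
  have hbdd : ∀ᵐ x ∂m, BddAbove (Set.range fun n => birkhoffMax T f n x) := by
    refine (hT.toPreErgodic.ae_mem_or_ae_notMem hmeas
      (Set.ext bddAbove_birkhoffMax_comp_iff)).resolve_right fun h => ?_
    exact hneg.not_ge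
      (integral_nonneg_of_ae_not_bddAbove_birkhoffMax hT.toMeasurePreserving hf h)
  filter_upwards [hbdd] with x hx
  exact hx.range_mono _ fun n => birkhoffSum_le_birkhoffMax n x

lemma Ergodic.ae_eventually_inv_mul_birkhoffSum_lt [IsProbabilityMeasure m] (hT : Ergodic T m)
    (hfm : Measurable f) (hf : Integrable f m) {c : ℝ} (hc : ∫ x, f x ∂m < c) :
    ∀ᵐ x ∂m, ∀ᶠ n : ℕ in atTop, (n : ℝ)⁻¹ * birkhoffSum T f n x < c := by
  obtain ⟨c', hc', hcc'⟩ := exists_between hc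
  have hneg : ∫ x, (f x - c') ∂m < 0 := by
    rw [integral_sub hf (integrable_const _)]
    simpa using hc'
  filter_upwards [hT.ae_bddAbove_birkhoffSum (hfm.sub_const c')
    (hf.sub (integrable_const _)) hneg] with x ⟨C, hC⟩
  have hlim : Tendsto (fun n : ℕ => c' + (n : ℝ)⁻¹ * C) atTop (𝓝 (c' + 0 * C)) :=
    (tendsto_inv_atTop_nhds_zero_nat.mul_const C).const_add c'
  filter_upwards [hlim.eventually_lt_const (by simpa using hcc'), eventually_gt_atTop 0]
    with n hn hpos
  refine lt_of_le_of_lt ?_ hn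
  have hle : birkhoffSum T (fun y => f y - c') n x ≤ C := hC ⟨n, rfl⟩
  rw [birkhoffSum_sub_const] at hle
  have hn0 : (0 : ℝ) < n := Nat.cast_pos.2 hpos
  calc (n : ℝ)⁻¹ * birkhoffSum T f n x ≤ (n : ℝ)⁻¹ * (n * c' + C) := by gcongr; linarith
    _ = c' + (n : ℝ)⁻¹ * C := by field_simp

/-- Birkhoff's pointwise ergodic theorem for an ergodic transformation. -/
theorem Ergodic.ae_tendsto_inv_mul_birkhoffSum [IsProbabilityMeasure m] (hT : Ergodic T m)
    (hfm : Measurable f) (hf : Integrable f m) :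
    ∀ᵐ x ∂m, Tendsto (fun n : ℕ => (n : ℝ)⁻¹ * birkhoffSum T f n x) atTop
      (𝓝 (∫ x, f x ∂m)) := by
  have hupper : ∀ᵐ x ∂m, ∀ k : ℕ, ∀ᶠ n : ℕ in atTop,
      (n : ℝ)⁻¹ * birkhoffSum T f n x < ∫ x, f x ∂m + 1 / ((k : ℝ) + 1) :=
    ae_all_iff.2 fun k => hT.ae_eventually_inv_mul_birkhoffSum_lt hfm hf
      (lt_add_of_pos_right _ Nat.one_div_pos_of_nat)
  have hlower : ∀ᵐ x ∂m, ∀ k : ℕ, ∀ᶠ n : ℕ in atTop,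
      (n : ℝ)⁻¹ * birkhoffSum T (fun y => -f y) n x < -∫ x, f x ∂m + 1 / ((k : ℝ) + 1) :=
    ae_all_iff.2 fun k => hT.ae_eventually_inv_mul_birkhoffSum_lt hfm.neg hf.neg
      (by rw [integral_neg']; exact lt_add_of_pos_right _ Nat.one_div_pos_of_nat)
  filter_upwards [hupper, hlower] with x hu hl
  refine Metric.tendsto_nhds.2 fun ε hε => ?_
  obtain ⟨k, hk⟩ := exists_nat_one_div_lt hε
  filter_upwards [hu k, hl k] with n hn hn'
  have hsum : birkhoffSum T (fun y => -f y) n x = -birkhoffSum T f n x := by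
    simp [birkhoffSum]
  rw [hsum, mul_neg] at hn'
  rw [Real.dist_eq, abs_lt]
  constructor <;> linarith

end BirkhoffMax

section Cocycle

variable {X G E : Type*} [Group G] {a : X → G → X}

lemma cocycle_one [AddGroup E] {σ : X → G → E} (hone : ∀ x, a x 1 = x)
    (hcoc : ∀ x (g h : G), σ x (g * h) = σ x g + σ (a x g) h) (x : X) : σ x 1 = 0 := by
  simpa [hone] using hcoc x 1 1

/-- Along the skew product, the Birkhoff sums of `(x, b) ↦ σ x (b 0)` are the values of the
cocycle `σ` at the partial products of `b`. -/
lemma birkhoffSum_skewProduct_eq_cocycle [AddCommGroup E] {σ : X → G → E}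
    (hone : ∀ x, a x 1 = x)
    (hcoc : ∀ x (g h : G), σ x (g * h) = σ x g + σ (a x g) h) (n : ℕ) (p : X × (ℕ → G)) :
    birkhoffSum (fun p : X × (ℕ → G) => (a p.1 (p.2 0), fun n => p.2 (n + 1)))
      (fun p => σ p.1 (p.2 0)) n p = σ p.1 ((List.range n).map p.2).prod := by
  induction n generalizing p with
  | zero => simp [cocycle_one hone hcoc]
  | succ n ih =>
    rw [birkhoffSum_succ', ih, List.range_succ_eq_map, List.map_cons, List.prod_cons, hcoc,
      List.map_map]
    rfl

variable [MeasurableSpace X] [MeasurableSpace G] {ν : Measure X} {μ : Measure G}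

/-- A cocycle has zero mean with respect to a stationary symmetric random walk. -/
lemma integral_cocycle_eq_zero [SFinite ν] [NeZero μ] [SFinite μ]
    [NormedAddCommGroup E] [NormedSpace ℝ E] {σ : X → G → E}
    (hsymm : Measure.map (fun g : G => g⁻¹) μ = μ)
    (hone : ∀ x, a x 1 = x)
    (hpres : ∀ᵐ g ∂μ, MeasurePreserving (fun x => a x g) ν ν)
    (hmeas : StronglyMeasurable fun p : X × G => σ p.1 p.2)
    (hcoc : ∀ x (g h : G), σ x (g * h) = σ x g + σ (a x g) h)
    (hint : Integrable (fun p : X × G => σ p.1 p.2) (ν.prod μ)) :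
    ∫ p, σ p.1 p.2 ∂(ν.prod μ) = 0 := by
  have hinv : AEMeasurable (fun g : G => g⁻¹) μ :=
    AEMeasurable.of_map_ne_zero (by rw [hsymm]; exact NeZero.ne μ)
  have hF : StronglyMeasurable fun g => ∫ x, σ x g ∂ν := hmeas.integral_prod_left'
  rw [integral_prod_symm _ hint]
  have hflip : ∫ g, ∫ x, σ x g ∂ν ∂μ = ∫ g, ∫ x, σ x g⁻¹ ∂ν ∂μ := by
    conv_lhs => rw [← hsymm]
    exact integral_map hinv hF.aestronglyMeasurable
  have hanti : ∫ g, ∫ x, σ x g⁻¹ ∂ν ∂μ = -∫ g, ∫ x, σ x g ∂ν ∂μ := by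
    rw [← integral_neg]
    refine integral_congr_ae ?_
    filter_upwards [hpres] with g hg
    have hslice : StronglyMeasurable fun x => σ x g⁻¹ :=
      hmeas.comp_measurable measurable_prodMk_right
    have hshift : ∫ x, σ x g⁻¹ ∂ν = ∫ x, σ (a x g) g⁻¹ ∂ν := by
      conv_lhs => rw [← hg.map_eq]
      exact integral_map hg.aemeasurable hslice.aestronglyMeasurable
    rw [hshift, ← integral_neg]
    refine integral_congr_ae (Eventually.of_forall fun x => ?_)
    have h := hcoc x g g⁻¹
    rw [mul_inv_cancel, cocycle_one hone hcoc] at h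
    exact (neg_eq_of_add_eq_zero_right h.symm).symm
  have := IsAddTorsionFree.of_isTorsionFree ℝ E
  exact self_eq_neg.1 (hflip.trans hanti)

end Cocycle

/-- Let a group `G` act measurably on the right on a probability space
`(X, ν)`. Let `μ` be a symmetric probability measure on `G` such that `μ`-almost every
`g` preserves `ν`, let `β = μ^⊗ℕ` be the product measure on `B = G^ℕ` (characterized
on cylinder sets), and assume the skew-product `T(x, b) = (x·b₀, shift b)` is
measure-preserving and ergodic for `ν ⊗ β`. If `σ : X × G → ℝ^d` is a
`ν ⊗ μ`-integrable cocycle, then for `ν ⊗ β`-almost every `(x, b)`,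
`(1/n) σ(x, b₀b₁⋯b_{n-1}) → 0`. -/
theorem drift_tendsto_zero_of_symmetric
    {X G : Type*} [MeasurableSpace X] [MeasurableSpace G] [Group G]
    (ν : Measure X) [IsProbabilityMeasure ν]
    (μ : Measure G) [IsProbabilityMeasure μ]
    (hsymm : Measure.map (fun g : G => g⁻¹) μ = μ)
    (a : X → G → X)
    (hone : ∀ x, a x 1 = x)
    (hmul : ∀ x (g h : G), a (a x g) h = a x (g * h))
    (hactmeas : Measurable fun p : X × G => a p.1 p.2)
    (hpres : ∀ᵐ g ∂μ, MeasurePreserving (fun x => a x g) ν ν)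
    (β : Measure (ℕ → G)) [IsProbabilityMeasure β]
    (hβ : ∀ (s : Finset ℕ) (A : ℕ → Set G), (∀ i ∈ s, MeasurableSet (A i)) →
      β {b | ∀ i ∈ s, b i ∈ A i} = ∏ i ∈ s, μ (A i))
    {d : ℕ} (σ : X → G → EuclideanSpace ℝ (Fin d))
    (hmeas : Measurable fun p : X × G => σ p.1 p.2)
    (hcoc : ∀ x (g h : G), σ x (g * h) = σ x g + σ (a x g) h)
    (hint : Integrable (fun p : X × G => σ p.1 p.2) (ν.prod μ))
    (T : X × (ℕ → G) → X × (ℕ → G))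
    (hT : T = fun p => (a p.1 (p.2 0), fun n => p.2 (n + 1)))
    (hErg : Ergodic T (ν.prod β)) :
    ∀ᵐ p ∂(ν.prod β),
      Tendsto (fun n : ℕ => (n : ℝ)⁻¹ • σ p.1 (((List.range n).map p.2).prod))
        atTop (𝓝 (0 : EuclideanSpace ℝ (Fin d))) := by
  have heval : MeasurePreserving (fun b : ℕ → G => b 0) β μ := by
    refine ⟨measurable_pi_apply 0, Measure.ext fun A hA => ?_⟩
    rw [Measure.map_apply (measurable_pi_apply 0) hA]
    simpa [Set.preimage] using hβ {0} (fun _ => A) fun _ _ => hA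
  have hproj : MeasurePreserving (fun p : X × (ℕ → G) => (p.1, p.2 0))
      (ν.prod β) (ν.prod μ) := (MeasurePreserving.id ν).prod heval
  have hcoord (i : Fin d) : ∀ᵐ p ∂(ν.prod β),
      Tendsto (fun n : ℕ => (n : ℝ)⁻¹ * σ p.1 (((List.range n).map p.2).prod) i)
        atTop (𝓝 0) := by
    have hmeasi : Measurable fun p : X × G => σ p.1 p.2 i :=
      (EuclideanSpace.proj (𝕜 := ℝ) i).continuous.measurable.comp hmeas
    have hinti : Integrable (fun p : X × G => σ p.1 p.2 i) (ν.prod μ) :=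
      (EuclideanSpace.proj (𝕜 := ℝ) i).integrable_comp hint
    have hcoci x (g h : G) : σ x (g * h) i = σ x g i + σ (a x g) h i := by
      rw [hcoc, PiLp.add_apply]
    have hzero : ∫ p : X × (ℕ → G), σ p.1 (p.2 0) i ∂(ν.prod β) = 0 := by
      rw [← integral_cocycle_eq_zero (σ := fun x g => σ x g i) hsymm hone hpres
        hmeasi.stronglyMeasurable hcoci hinti, ← hproj.map_eq]
      exact (integral_map hproj.aemeasurable hmeasi.aestronglyMeasurable).symm
    filter_upwards [hErg.ae_tendsto_inv_mul_birkhoffSum (hmeasi.comp hproj.measurable)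
      (hproj.integrable_comp_of_integrable hinti)] with p hp
    simp only [Function.comp_def] at hp
    rw [hzero, hT] at hp
    refine hp.congr fun n => ?_
    rw [birkhoffSum_skewProduct_eq_cocycle (σ := fun x g => σ x g i) hone hcoci]
  filter_upwards [ae_all_iff.2 hcoord] with p hp
  exact ((PiLp.continuous_toLp 2 _).tendsto (0 : Fin d → ℝ)).comp (tendsto_pi_nhds.2 hp)
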